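/- arXiv:2511.10928 — 8 statements merged into one kernel-verified Lean document; each statement's English description precedes it below -/
import Mathlib

section
/- Let n ≥ 1, let s, y ∈ ℝⁿ with ⟨y, s⟩ ≠ 0, and let λ, t ∈ ℝ. Define the n×n real matrix Q = λ·I − (λ/(2⟨y,s⟩))·(y sᵀ) − (λ/(2⟨y,s⟩))·(s yᵀ) + (t/⟨y,s⟩)·(s sᵀ). Then the trace of QᵀQ equals λ²(n − 3/2) + (λ²/2)·‖s‖²‖y‖²/⟨y,s⟩² + t²·‖s‖⁴/⟨y,s⟩². -/
open Matrix BigOperators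

/-- Lemma 2.2: trace of QᵀQ for the generalized Perry update matrix. -/
theorem trace_transpose_mul_generalized_perry (n : ℕ) (hn : 1 ≤ n) (s y : Fin n → ℝ)
    (hys : (∑ i, y i * s i) ≠ 0) (lam t : ℝ)
    (Q : Matrix (Fin n) (Fin n) ℝ)
    (hQ : Q = lam • (1 : Matrix (Fin n) (Fin n) ℝ)
        - (lam / (2 * (∑ i, y i * s i))) • Matrix.vecMulVec y s
        - (lam / (2 * (∑ i, y i * s i))) • Matrix.vecMulVec s y
        + (t / (∑ i, y i * s i)) • Matrix.vecMulVec s s) :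
    Matrix.trace (Qᵀ * Q)
      = lam ^ 2 * ((n : ℝ) - 3 / 2)
        + lam ^ 2 / 2 * ((∑ i, s i ^ 2) * (∑ i, y i ^ 2)) / (∑ i, y i * s i) ^ 2
        + t ^ 2 * (∑ i, s i ^ 2) ^ 2 / (∑ i, y i * s i) ^ 2 := by
  have hs : ∑ i, s i ^ 2 = s ⬝ᵥ s := by simp [dotProduct, sq]
  have hy : ∑ i, y i ^ 2 = y ⬝ᵥ y := by simp [dotProduct, sq]
  have hd : ∑ i, y i * s i = y ⬝ᵥ s := rfl
  rw [hd] at hys hQ ⊢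
  rw [hs, hy, hQ]
  simp only [transpose_add, transpose_sub, transpose_smul, transpose_one, transpose_vecMulVec,
    add_mul, mul_add, sub_mul, mul_sub, smul_mul_assoc, mul_smul_comm, one_mul, mul_one,
    vecMulVec_mul_vecMulVec, trace_add, trace_sub, trace_smul, trace_one, trace_vecMulVec,
    dotProduct_smul, smul_eq_mul, Fintype.card_fin, dotProduct_comm s y]
  field_simp
  ring
end

section
/- Let G : ℝⁿ → ℝⁿ be Lipschitz continuous with constant L ≥ 0, let x, p ∈ ℝⁿ, and let α_min > 0, ζ > 0, ζ₂ > 0, ρ ∈ (0,1), α > 0, and c ∈ ℝ with 0 < c ≤ ζ₂. Assume the sufficient descent condition ⟨G(x), p⟩ ≤ −α_min·‖G(x)‖² and that the line search fails at step size α/ρ, i.e. ⟨G(x + (α/ρ)·p), p⟩ > −ζ·(α/ρ)·‖p‖²·c. Then ‖G(x)‖² ≤ (α·(L + ζ·ζ₂)/(ρ·α_min))·‖p‖²; consequently α ≥ (ρ·α_min/(L + ζ·ζ₂))·‖G(x)‖²/‖p‖². -/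
open RealInnerProductSpace

/-- Lemma 2.6: lower bound on the accepted step size of the Generalized MOPCGM
line search. -/
theorem gmopcgm_stepsize_lower_bound {n : ℕ}
    (G : EuclideanSpace ℝ (Fin n) → EuclideanSpace ℝ (Fin n))
    (L : ℝ) (hL : 0 ≤ L) (hLip : ∀ u v, ‖G u - G v‖ ≤ L * ‖u - v‖)
    (x p : EuclideanSpace ℝ (Fin n))
    (αmin ζ ζ₂ ρ α c : ℝ)
    (hαmin : 0 < αmin) (hζ : 0 < ζ) (hζ₂ : 0 < ζ₂) (hρ0 : 0 < ρ) (hρ1 : ρ < 1)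
    (hα : 0 < α) (hc0 : 0 < c) (hcζ₂ : c ≤ ζ₂)
    (hdesc : ⟪G x, p⟫ ≤ -(αmin * ‖G x‖ ^ 2))
    (hfail : -(ζ * (α / ρ) * ‖p‖ ^ 2 * c) < ⟪G (x + (α / ρ) • p), p⟫) :
    ‖G x‖ ^ 2 ≤ α * (L + ζ * ζ₂) / (ρ * αmin) * ‖p‖ ^ 2 ∧
    ρ * αmin / (L + ζ * ζ₂) * (‖G x‖ ^ 2 / ‖p‖ ^ 2) ≤ α := by
  have ht : 0 < α / ρ := div_pos hα hρ0
  have hK : 0 < L + ζ * ζ₂ := by positivity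
  have hstep : ‖G (x + (α / ρ) • p) - G x‖ ≤ L * (α / ρ * ‖p‖) := by
    simpa [norm_smul, abs_of_pos hα, abs_of_pos hρ0] using hLip (x + (α / ρ) • p) x
  have hinner : ⟪G (x + (α / ρ) • p), p⟫ - ⟪G x, p⟫ ≤ L * (α / ρ * ‖p‖) * ‖p‖ := by
    rw [← inner_sub_left]
    exact (real_inner_le_norm _ _).trans (by gcongr)
  have hclamp : ζ * (α / ρ) * ‖p‖ ^ 2 * c ≤ ζ * (α / ρ) * ‖p‖ ^ 2 * ζ₂ := by gcongr
  have hmain : αmin * ‖G x‖ ^ 2 ≤ α / ρ * (L + ζ * ζ₂) * ‖p‖ ^ 2 := by linarith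
  have hbound : ‖G x‖ ^ 2 ≤ α * (L + ζ * ζ₂) / (ρ * αmin) * ‖p‖ ^ 2 := by
    have heq : α * (L + ζ * ζ₂) / (ρ * αmin) * ‖p‖ ^ 2 =
        α / ρ * (L + ζ * ζ₂) * ‖p‖ ^ 2 / αmin := by
      field_simp
    rw [heq, le_div_iff₀' hαmin]
    exact hmain
  refine ⟨hbound, ?_⟩
  have hratio : ‖G x‖ ^ 2 / ‖p‖ ^ 2 ≤ α * (L + ζ * ζ₂) / (ρ * αmin) :=
    div_le_of_le_mul₀ (by positivity) (by positivity) hbound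
  calc ρ * αmin / (L + ζ * ζ₂) * (‖G x‖ ^ 2 / ‖p‖ ^ 2)
      ≤ ρ * αmin / (L + ζ * ζ₂) * (α * (L + ζ * ζ₂) / (ρ * αmin)) := by gcongr
    _ = α := by field_simp
end

section
/- Let G, p′, s, v ∈ ℝⁿ and α > 0, τ > 0, c ≥ 0, α_max > 0, and λ ∈ ℝ with 0 < λ ≤ α_max. Assume p′ ≠ 0, s = α·p′, ‖v‖ ≤ c·‖s‖, and ⟨p′, v⟩ ≥ τ·α·‖p′‖². Define t* = λ·⟨s, v⟩/‖s‖² and θ = ⟨v − t*·s, G⟩/⟨p′, v⟩. Then |θ| ≤ (1 + α_max)·c·‖G‖/(τ·‖p′‖). -/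
open RealInnerProductSpace

/-- Rescaling the projection of `v` onto the line of `s` by a factor `lam ≥ 0` gives a vector of
norm at most `lam * ‖v‖`. -/
lemma norm_mul_inner_div_norm_sq_smul_le {E : Type*} [NormedAddCommGroup E]
    [InnerProductSpace ℝ E] (s v : E) {lam : ℝ} (hlam : 0 ≤ lam) :
    ‖(lam * ⟪s, v⟫ / ‖s‖ ^ 2) • s‖ ≤ lam * ‖v‖ := by
  rcases eq_or_ne s 0 with rfl | hs
  · simpa using mul_nonneg hlam (norm_nonneg v)
  have hs' : 0 < ‖s‖ := norm_pos_iff.mpr hs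
  calc ‖(lam * ⟪s, v⟫ / ‖s‖ ^ 2) • s‖ = lam * |⟪s, v⟫| / ‖s‖ ^ 2 * ‖s‖ := by
        rw [norm_smul, Real.norm_eq_abs, abs_div, abs_mul, abs_of_nonneg hlam,
          abs_of_nonneg (sq_nonneg ‖s‖)]
    _ ≤ lam * (‖s‖ * ‖v‖) / ‖s‖ ^ 2 * ‖s‖ := by
        gcongr
        exact abs_real_inner_le_norm s v
    _ = lam * ‖v‖ := by field_simp

/-- The key estimate (2.33) bounding the conjugate parameter of the Generalized
MOPCGM. -/
theorem gmopcgm_theta_bound {n : ℕ}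
    (G p' s v : EuclideanSpace ℝ (Fin n))
    (α τ c αmax lam : ℝ)
    (hα : 0 < α) (hτ : 0 < τ) (hc : 0 ≤ c) (hαmax : 0 < αmax)
    (hlam0 : 0 < lam) (hlam : lam ≤ αmax)
    (hp' : p' ≠ 0) (hs : s = α • p')
    (hv : ‖v‖ ≤ c * ‖s‖) (hpv : τ * α * ‖p'‖ ^ 2 ≤ ⟪p', v⟫)
    (tstar : ℝ) (htstar : tstar = lam * ⟪s, v⟫ / ‖s‖ ^ 2)
    (θ : ℝ) (hθ : θ = ⟪v - tstar • s, G⟫ / ⟪p', v⟫) :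
    |θ| ≤ (1 + αmax) * c * ‖G‖ / (τ * ‖p'‖) := by
  have hp : 0 < ‖p'‖ := norm_pos_iff.mpr hp'
  have hden : 0 < τ * α * ‖p'‖ ^ 2 := by positivity
  have hs_norm : ‖s‖ = α * ‖p'‖ := by rw [hs, norm_smul, Real.norm_of_nonneg hα.le]
  have hnum : ‖v - tstar • s‖ ≤ (1 + αmax) * (c * (α * ‖p'‖)) := by
    calc ‖v - tstar • s‖ ≤ ‖v‖ + ‖tstar • s‖ := norm_sub_le _ _
      _ ≤ ‖v‖ + lam * ‖v‖ := by
          gcongr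
          exact htstar ▸ norm_mul_inner_div_norm_sq_smul_le s v hlam0.le
      _ = (1 + lam) * ‖v‖ := by ring
      _ ≤ (1 + αmax) * (c * (α * ‖p'‖)) := by
          gcongr
          exact hs_norm ▸ hv
  calc |θ| = |⟪v - tstar • s, G⟫| / ⟪p', v⟫ := by
        rw [hθ, abs_div, abs_of_pos (hden.trans_le hpv)]
    _ ≤ (1 + αmax) * (c * (α * ‖p'‖)) * ‖G‖ / (τ * α * ‖p'‖ ^ 2) := by
        gcongr
        exact (abs_real_inner_le_norm _ _).trans (by gcongr)
    _ = (1 + αmax) * c * ‖G‖ / (τ * ‖p'‖) := by field_simp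
end

section
/- Let E be a real inner product space, let G, p′ ∈ E with G ≠ 0 and p′ ≠ 0, let λ, θ ∈ ℝ and α_min, α_max, c, τ > 0 with α_min ≤ λ ≤ α_max. Define p = −(λ + θ·⟨G, p′⟩/‖G‖²)·G + θ·p′, and assume |θ|·‖p′‖ ≤ (1 + α_max)·(c/τ)·‖G‖. Then α_min·‖G‖ ≤ ‖p‖ ≤ κ·‖G‖, where κ = α_max + 2·(1 + α_max)·c/τ. -/
open RealInnerProductSpace

/-- The descent identity of the three-term direction. -/
theorem inner_three_term_direction {E : Type*} [NormedAddCommGroup E]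
    [InnerProductSpace ℝ E] {G : E} (hG : G ≠ 0) (d : E) (lam θ : ℝ) :
    ⟪G, -((lam + θ * ⟪G, d⟫ / ‖G‖ ^ 2) • G) + θ • d⟫ = -(lam * ‖G‖ ^ 2) := by
  have hG' : ‖G‖ ≠ 0 := norm_ne_zero_iff.mpr hG
  rw [inner_add_right, inner_neg_right, real_inner_smul_right, real_inner_smul_right,
    real_inner_self_eq_norm_sq]
  field_simp
  ring

/-- The norm of the three-term direction is controlled by its coefficients. -/
theorem norm_three_term_direction_le {E : Type*} [NormedAddCommGroup E]
    [InnerProductSpace ℝ E] {G : E} (hG : G ≠ 0) (d : E) (lam θ : ℝ) :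
    ‖-((lam + θ * ⟪G, d⟫ / ‖G‖ ^ 2) • G) + θ • d‖ ≤ |lam| * ‖G‖ + 2 * (|θ| * ‖d‖) := by
  have hG' : 0 < ‖G‖ := norm_pos_iff.mpr hG
  have h_coeff : |θ * ⟪G, d⟫ / ‖G‖ ^ 2| * ‖G‖ ≤ |θ| * ‖d‖ := by
    rw [abs_div, abs_mul, abs_of_pos (pow_pos hG' 2)]
    calc |θ| * |⟪G, d⟫| / ‖G‖ ^ 2 * ‖G‖
        ≤ |θ| * (‖G‖ * ‖d‖) / ‖G‖ ^ 2 * ‖G‖ := by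
          gcongr
          exact abs_real_inner_le_norm G d
      _ = |θ| * ‖d‖ := by field_simp
  calc ‖-((lam + θ * ⟪G, d⟫ / ‖G‖ ^ 2) • G) + θ • d‖
      ≤ |lam + θ * ⟪G, d⟫ / ‖G‖ ^ 2| * ‖G‖ + |θ| * ‖d‖ := by
        refine (norm_add_le _ _).trans_eq ?_
        rw [norm_neg, norm_smul, norm_smul, Real.norm_eq_abs, Real.norm_eq_abs]
    _ ≤ (|lam| + |θ * ⟪G, d⟫ / ‖G‖ ^ 2|) * ‖G‖ + |θ| * ‖d‖ := by
        gcongr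
        exact abs_add_le _ _
    _ ≤ |lam| * ‖G‖ + 2 * (|θ| * ‖d‖) := by linarith

/-- Lemma 2.7: trust-region property of the Generalized MOPCGM direction. -/
theorem gmopcgm_trust_region {E : Type*} [NormedAddCommGroup E]
    [InnerProductSpace ℝ E] (G p' : E) (hG : G ≠ 0) (hp' : p' ≠ 0)
    (lam θ αmin αmax c τ : ℝ)
    (hαmin : 0 < αmin) (hαmax : 0 < αmax) (hc : 0 < c) (hτ : 0 < τ)
    (hlam1 : αmin ≤ lam) (hlam2 : lam ≤ αmax)
    (p : E) (hp : p = -((lam + θ * ⟪G, p'⟫ / ‖G‖ ^ 2) • G) + θ • p')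
    (hθ : |θ| * ‖p'‖ ≤ (1 + αmax) * (c / τ) * ‖G‖) :
    αmin * ‖G‖ ≤ ‖p‖ ∧ ‖p‖ ≤ (αmax + 2 * (1 + αmax) * c / τ) * ‖G‖ := by
  have hG' : 0 < ‖G‖ := norm_pos_iff.mpr hG
  subst hp
  constructor
  · have h_descent := inner_three_term_direction hG p' lam θ
    have h_cauchy := (neg_le_abs _).trans (abs_real_inner_le_norm G
      (-((lam + θ * ⟪G, p'⟫ / ‖G‖ ^ 2) • G) + θ • p'))
    rw [h_descent] at h_cauchy
    refine (mul_le_mul_of_nonneg_right hlam1 hG'.le).trans (le_of_mul_le_mul_left ?_ hG')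
    linarith
  · calc _ ≤ |lam| * ‖G‖ + 2 * (|θ| * ‖p'‖) := norm_three_term_direction_le hG p' lam θ
      _ ≤ αmax * ‖G‖ + 2 * ((1 + αmax) * (c / τ) * ‖G‖) := by
        rw [abs_of_pos (hαmin.trans_le hlam1)]
        gcongr
      _ = _ := by ring
end

section
/- Let E be a real inner product space, let x, z, x* ∈ E and g ∈ E with g ≠ 0, let γ ∈ ℝ with 0 < γ < 2, and let ζ > 0. Assume ⟨g, x − x*⟩ ≥ ⟨g, x − z⟩ and ⟨g, x − z⟩ ≥ ζ·‖x − z‖²·‖g‖. Set μ = ⟨g, x − z⟩/‖g‖² and y = x − γ·μ·g. Then ‖y − x*‖² ≤ ‖x − x*‖² − γ·(2 − γ)·ζ²·‖x − z‖⁴. -/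
open RealInnerProductSpace

/-- The contraction inequality (2.41) of Lemma 2.8 for the relaxed projection step. -/
theorem relaxed_projection_contraction {E : Type*} [NormedAddCommGroup E]
    [InnerProductSpace ℝ E] (x z xstar g : E) (hg : g ≠ 0)
    (γ ζ : ℝ) (hγ0 : 0 < γ) (hγ2 : γ < 2) (hζ : 0 < ζ)
    (h1 : ⟪g, x - z⟫ ≤ ⟪g, x - xstar⟫)
    (h2 : ζ * ‖x - z‖ ^ 2 * ‖g‖ ≤ ⟪g, x - z⟫)
    (μ : ℝ) (hμ : μ = ⟪g, x - z⟫ / ‖g‖ ^ 2)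
    (y : E) (hy : y = x - (γ * μ) • g) :
    ‖y - xstar‖ ^ 2 ≤ ‖x - xstar‖ ^ 2 - γ * (2 - γ) * ζ ^ 2 * ‖x - z‖ ^ 4 := by
  have hn : 0 < ‖g‖ := norm_pos_iff.mpr hg
  have ha : ⟪g, x - z⟫ = μ * ‖g‖ ^ 2 := by
    rw [hμ]
    field_simp
  have hstep : ζ * ‖x - z‖ ^ 2 ≤ μ * ‖g‖ := by
    refine le_of_mul_le_mul_right ?_ hn
    linarith
  have hμ0 : 0 ≤ μ := by
    rw [hμ]
    have : 0 ≤ ⟪g, x - z⟫ := le_trans (by positivity) h2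
    positivity
  have hsq : (ζ * ‖x - z‖ ^ 2) ^ 2 ≤ (μ * ‖g‖) ^ 2 :=
    pow_le_pow_left₀ (by positivity) hstep 2
  have hexp : ‖y - xstar‖ ^ 2
      = ‖x - xstar‖ ^ 2 - 2 * (γ * μ) * ⟪g, x - xstar⟫ + (γ * μ) ^ 2 * ‖g‖ ^ 2 := by
    rw [hy, sub_right_comm, norm_sub_sq_real, real_inner_smul_right, norm_smul,
      real_inner_comm, mul_pow, Real.norm_eq_abs, sq_abs]
    ring
  have hmono : γ * μ * (μ * ‖g‖ ^ 2) ≤ γ * μ * ⟪g, x - xstar⟫ :=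
    mul_le_mul_of_nonneg_left (ha ▸ h1) (by positivity)
  have hscale : γ * (2 - γ) * (ζ * ‖x - z‖ ^ 2) ^ 2 ≤ γ * (2 - γ) * (μ * ‖g‖) ^ 2 :=
    mul_le_mul_of_nonneg_left hsq (mul_nonneg hγ0.le (sub_nonneg.mpr hγ2.le))
  rw [hexp]
  linarith
end

section
/- Let E be a real inner product space, let Γ ⊆ E, let x, z, x* ∈ E with x* ∈ Γ, let g ∈ E with g ≠ 0, let γ ∈ ℝ with 0 < γ < 2, and let ζ > 0. Assume ⟨g, x − x*⟩ ≥ ⟨g, x − z⟩, and ⟨g, x − z⟩ ≥ ζ·‖x − z‖²·‖g‖. Set μ = ⟨g, x − z⟩/‖g‖² and y = x − γ·μ·g, and suppose q ∈ Γ is the metric projection of y onto Γ in the variational sense: ⟨y − q, w − q⟩ ≤ 0 for all w ∈ Γ. Then ‖q − x*‖² ≤ ‖x − x*‖² − γ·(2 − γ)·ζ²·‖x − z‖⁴; in particular ‖q − x*‖ ≤ ‖x − x*‖. -/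
open RealInnerProductSpace

/-- A point satisfying the projection inequality for `y` at `w` is no farther from `w` than `y`. -/
theorem norm_sub_sq_le_of_inner_sub_sub_nonpos {E : Type*} [NormedAddCommGroup E]
    [InnerProductSpace ℝ E] {y q w : E} (h : ⟪y - q, w - q⟫ ≤ 0) :
    ‖q - w‖ ^ 2 ≤ ‖y - w‖ ^ 2 := by
  have key := norm_sub_sq_real (y - q) (w - q)
  rw [sub_sub_sub_cancel_right, norm_sub_rev w q] at key
  nlinarith [sq_nonneg ‖y - q‖]

/-- A relaxed projection step onto the hyperplane `⟪g, x - ·⟫ = s` decreases the squared distance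
to every point `w` on its far side. -/
theorem norm_sub_smul_sub_sq_le {E : Type*} [NormedAddCommGroup E] [InnerProductSpace ℝ E]
    {x w g : E} (hg : g ≠ 0) {γ s : ℝ} (hγ : 0 ≤ γ) (hs : 0 ≤ s) (h : s ≤ ⟪g, x - w⟫) :
    ‖x - (γ * (s / ‖g‖ ^ 2)) • g - w‖ ^ 2 ≤ ‖x - w‖ ^ 2 - γ * (2 - γ) * (s / ‖g‖) ^ 2 := by
  have hg' : ‖g‖ ≠ 0 := norm_ne_zero_iff.mpr hg
  have hstep : 0 ≤ γ * (s / ‖g‖ ^ 2) := by positivity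
  rw [sub_right_comm, norm_sub_sq_real, real_inner_smul_right, real_inner_comm, norm_smul,
    Real.norm_of_nonneg hstep]
  have hsq : γ * (2 - γ) * (s / ‖g‖) ^ 2 =
      2 * (γ * (s / ‖g‖ ^ 2) * s) - (γ * (s / ‖g‖ ^ 2) * ‖g‖) ^ 2 := by
    field_simp
  linarith [mul_le_mul_of_nonneg_left h hstep]

/-- Lemma 2.8 (projection-step inequality): the projected iterate is closer to any
solution `x*` with a quantified decrease. -/
theorem projection_step_contraction {E : Type*} [NormedAddCommGroup E]
    [InnerProductSpace ℝ E] (Γ : Set E) (x z xstar : E) (hxstar : xstar ∈ Γ)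
    (g : E) (hg : g ≠ 0)
    (γ ζ : ℝ) (hγ0 : 0 < γ) (hγ2 : γ < 2) (hζ : 0 < ζ)
    (h1 : ⟪g, x - z⟫ ≤ ⟪g, x - xstar⟫)
    (h2 : ζ * ‖x - z‖ ^ 2 * ‖g‖ ≤ ⟪g, x - z⟫)
    (μ : ℝ) (hμ : μ = ⟪g, x - z⟫ / ‖g‖ ^ 2)
    (y : E) (hy : y = x - (γ * μ) • g)
    (q : E) (hqΓ : q ∈ Γ) (hq : ∀ w ∈ Γ, ⟪y - q, w - q⟫ ≤ 0) :
    ‖q - xstar‖ ^ 2 ≤ ‖x - xstar‖ ^ 2 - γ * (2 - γ) * ζ ^ 2 * ‖x - z‖ ^ 4 ∧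
    ‖q - xstar‖ ≤ ‖x - xstar‖ := by
  have hs : 0 ≤ ⟪g, x - z⟫ := le_trans (by positivity) h2
  have hγ : 0 ≤ γ * (2 - γ) := mul_nonneg hγ0.le (sub_nonneg.mpr hγ2.le)
  have hstep := norm_sub_smul_sub_sq_le hg hγ0.le hs h1
  rw [← hμ, ← hy] at hstep
  have hratio : ζ * ‖x - z‖ ^ 2 ≤ ⟪g, x - z⟫ / ‖g‖ :=
    (le_div_iff₀ (norm_pos_iff.mpr hg)).mpr h2
  have hdecr : γ * (2 - γ) * (ζ * ‖x - z‖ ^ 2) ^ 2 ≤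
      γ * (2 - γ) * (⟪g, x - z⟫ / ‖g‖) ^ 2 := by
    gcongr
  have hmain : ‖q - xstar‖ ^ 2 ≤
      ‖x - xstar‖ ^ 2 - γ * (2 - γ) * ζ ^ 2 * ‖x - z‖ ^ 4 := by
    linarith [norm_sub_sq_le_of_inner_sub_sub_nonpos (hq xstar hxstar)]
  refine ⟨hmain, (sq_le_sq₀ (norm_nonneg _) (norm_nonneg _)).mp ?_⟩
  exact hmain.trans (sub_le_self _ (by positivity))
end

section
/- Let E be a real inner product space, let G, p′, w ∈ E with ⟨p′, w⟩ ≠ 0, let τ ≥ 0 and λ > 0 with α_min ≤ λ ≤ α_max for some α_min ≥ (1+τ)/2. Define a = ⟨G, p′⟩/⟨w, p′⟩, θ = ⟨G, w⟩/⟨p′, w⟩ − λ·(‖w‖²/⟨p′, w⟩)·(⟨G, p′⟩/⟨p′, w⟩), and p = −λ·G + θ·p′ + τ·a·w. Then ⟨G, p⟩ ≤ −(λ − (1+τ)²/(4λ))·‖G‖² ≤ −α_min·(1 − (1+τ)²/(4·α_min²))·‖G‖², and the coefficient α_min·(1 − (1+τ)²/(4α_min²)) is nonnegative. -/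
open RealInnerProductSpace

/-- Young's inequality for the inner product, with a weight `c` and a parameter `r > 0`. -/
lemma mul_inner_sub_mul_norm_sq_le {E : Type*} [NormedAddCommGroup E] [InnerProductSpace ℝ E]
    (x y : E) (c : ℝ) {r : ℝ} (hr : 0 < r) :
    c * ⟪x, y⟫ - r * ‖y‖ ^ 2 ≤ c ^ 2 / (4 * r) * ‖x‖ ^ 2 := by
  have h : 0 ≤ ‖(c / 2) • x - r • y‖ ^ 2 := sq_nonneg _
  rw [norm_sub_sq_real, norm_smul, norm_smul, real_inner_smul_left, real_inner_smul_right,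
    mul_pow, mul_pow, Real.norm_eq_abs, Real.norm_eq_abs, sq_abs, sq_abs] at h
  rw [div_mul_eq_mul_div, le_div_iff₀ (by positivity)]
  linarith

/-- Lemma 2.11: sufficient descent condition for the Generalized CGPM direction. -/
theorem gcgpm_sufficient_descent {E : Type*} [NormedAddCommGroup E]
    [InnerProductSpace ℝ E] (G p' w : E) (hpw : ⟪p', w⟫ ≠ 0)
    (τ lam αmin αmax : ℝ) (hτ : 0 ≤ τ) (hlam : 0 < lam)
    (hαmin : (1 + τ) / 2 ≤ αmin) (h1 : αmin ≤ lam) (h2 : lam ≤ αmax)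
    (a : ℝ) (ha : a = ⟪G, p'⟫ / ⟪w, p'⟫)
    (θ : ℝ) (hθ : θ = ⟪G, w⟫ / ⟪p', w⟫ - lam * (‖w‖ ^ 2 / ⟪p', w⟫) * (⟪G, p'⟫ / ⟪p', w⟫))
    (p : E) (hp : p = -(lam • G) + θ • p' + (τ * a) • w) :
    ⟪G, p⟫ ≤ -((lam - (1 + τ) ^ 2 / (4 * lam)) * ‖G‖ ^ 2) ∧
    -((lam - (1 + τ) ^ 2 / (4 * lam)) * ‖G‖ ^ 2)
        ≤ -(αmin * (1 - (1 + τ) ^ 2 / (4 * αmin ^ 2)) * ‖G‖ ^ 2) ∧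
    0 ≤ αmin * (1 - (1 + τ) ^ 2 / (4 * αmin ^ 2)) := by
  have hαpos : 0 < αmin := by linarith
  have hcoef : αmin * (1 - (1 + τ) ^ 2 / (4 * αmin ^ 2)) = αmin - (1 + τ) ^ 2 / (4 * αmin) := by
    field_simp
  rw [hcoef]
  refine ⟨?_, ?_, ?_⟩
  · have hinner : ⟪G, p⟫ =
        -(lam * ‖G‖ ^ 2) + ((1 + τ) * ⟪G, a • w⟫ - lam * ‖a • w‖ ^ 2) := by
      rw [norm_smul, mul_pow, Real.norm_eq_abs, sq_abs, hp, hθ, ha, real_inner_comm p' w]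
      simp only [inner_add_right, inner_neg_right, real_inner_smul_right,
        real_inner_self_eq_norm_sq]
      field_simp
      ring
    linarith [mul_inner_sub_mul_norm_sq_le G (a • w) (1 + τ) hlam]
  · gcongr
  · rw [sub_nonneg, div_le_iff₀ (by positivity)]
    nlinarith
end

section
/- Let G : ℝⁿ → ℝⁿ be Lipschitz continuous with constant L ≥ 0, let x, p ∈ ℝⁿ, let τ ≥ 0 and α_min > (1+τ)/2, let ζ > 0, ζ₂ > 0, ρ ∈ (0,1), α > 0, and c ∈ ℝ with 0 < c ≤ ζ₂. Assume the descent condition ⟨G(x), p⟩ ≤ −α_min·(1 − (1+τ)²/(4·α_min²))·‖G(x)‖² and that the line search fails at step size α/ρ, i.e. ⟨G(x + (α/ρ)·p), p⟩ > −ζ·(α/ρ)·‖p‖²·c. Then ‖G(x)‖² ≤ (4·α·α_min·(L + ζ·ζ₂)/(ρ·(4·α_min² − (1+τ)²)))·‖p‖²; consequently α ≥ (ρ·(4α_min² − (1+τ)²)/(4α_min·(L + ζζ₂)))·‖G(x)‖²/‖p‖². -/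
open RealInnerProductSpace

/-- Along a direction `p`, the directional component of an `L`-Lipschitz map grows at most
linearly. -/
theorem inner_sub_le_of_norm_sub_le {E : Type*} [NormedAddCommGroup E] [InnerProductSpace ℝ E]
    (G : E → E) {L : ℝ} (hLip : ∀ u v, ‖G u - G v‖ ≤ L * ‖u - v‖) (x p : E) {t : ℝ}
    (ht : 0 ≤ t) : ⟪G (x + t • p), p⟫ - ⟪G x, p⟫ ≤ L * t * ‖p‖ ^ 2 :=
  calc ⟪G (x + t • p), p⟫ - ⟪G x, p⟫ = ⟪G (x + t • p) - G x, p⟫ := by rw [inner_sub_left]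
    _ ≤ ‖G (x + t • p) - G x‖ * ‖p‖ := real_inner_le_norm _ _
    _ ≤ L * ‖x + t • p - x‖ * ‖p‖ := by gcongr; exact hLip _ _
    _ = L * t * ‖p‖ ^ 2 := by
      rw [add_sub_cancel_left, norm_smul, Real.norm_of_nonneg ht]
      ring

/-- Lemma 2.12: lower bound on the accepted step size of the Generalized CGPM
line search. -/
theorem gcgpm_stepsize_lower_bound {n : ℕ}
    (G : EuclideanSpace ℝ (Fin n) → EuclideanSpace ℝ (Fin n))
    (L : ℝ) (hL : 0 ≤ L) (hLip : ∀ u v, ‖G u - G v‖ ≤ L * ‖u - v‖)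
    (x p : EuclideanSpace ℝ (Fin n))
    (τ αmin ζ ζ₂ ρ α c : ℝ)
    (hτ : 0 ≤ τ) (hαmin : (1 + τ) / 2 < αmin)
    (hζ : 0 < ζ) (hζ₂ : 0 < ζ₂) (hρ0 : 0 < ρ) (hρ1 : ρ < 1)
    (hα : 0 < α) (hc0 : 0 < c) (hcζ₂ : c ≤ ζ₂)
    (hdesc : ⟪G x, p⟫ ≤ -(αmin * (1 - (1 + τ) ^ 2 / (4 * αmin ^ 2)) * ‖G x‖ ^ 2))
    (hfail : -(ζ * (α / ρ) * ‖p‖ ^ 2 * c) < ⟪G (x + (α / ρ) • p), p⟫) :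
    ‖G x‖ ^ 2 ≤ 4 * α * αmin * (L + ζ * ζ₂) / (ρ * (4 * αmin ^ 2 - (1 + τ) ^ 2)) * ‖p‖ ^ 2 ∧
    ρ * (4 * αmin ^ 2 - (1 + τ) ^ 2) / (4 * αmin * (L + ζ * ζ₂))
        * (‖G x‖ ^ 2 / ‖p‖ ^ 2) ≤ α := by
  have ha : 0 < αmin := by linarith
  have hD : 0 < 4 * αmin ^ 2 - (1 + τ) ^ 2 := by nlinarith
  have hM : 0 < L + ζ * ζ₂ := by positivity
  have hdescent_coeff : αmin * (1 - (1 + τ) ^ 2 / (4 * αmin ^ 2))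
      = (4 * αmin ^ 2 - (1 + τ) ^ 2) / (4 * αmin) := by
    field_simp
  rw [hdescent_coeff] at hdesc
  have hinner := inner_sub_le_of_norm_sub_le G hLip x p (div_pos hα hρ0).le
  have hclamp : ζ * (α / ρ) * ‖p‖ ^ 2 * c ≤ ζ * (α / ρ) * ‖p‖ ^ 2 * ζ₂ := by gcongr
  have hbound : (4 * αmin ^ 2 - (1 + τ) ^ 2) / (4 * αmin) * ‖G x‖ ^ 2
      ≤ α / ρ * (L + ζ * ζ₂) * ‖p‖ ^ 2 := by linarith
  have hcleared : ρ * (4 * αmin ^ 2 - (1 + τ) ^ 2) * ‖G x‖ ^ 2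
      ≤ 4 * α * αmin * (L + ζ * ζ₂) * ‖p‖ ^ 2 :=
    calc ρ * (4 * αmin ^ 2 - (1 + τ) ^ 2) * ‖G x‖ ^ 2
        = 4 * αmin * ρ * ((4 * αmin ^ 2 - (1 + τ) ^ 2) / (4 * αmin) * ‖G x‖ ^ 2) := by
          field_simp
      _ ≤ 4 * αmin * ρ * (α / ρ * (L + ζ * ζ₂) * ‖p‖ ^ 2) := by gcongr
      _ = 4 * α * αmin * (L + ζ * ζ₂) * ‖p‖ ^ 2 := by field_simp
  have hp : 0 < ‖p‖ := by
    refine norm_pos_iff.mpr ?_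
    rintro rfl
    simp at hfail
  constructor
  · rw [div_mul_eq_mul_div, le_div_iff₀ (by positivity)]
    linarith
  · rw [div_mul_div_comm, div_le_iff₀ (by positivity)]
    linarith
end
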